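/- Let θ_0 = 1, θ_1, …, θ_q be real numbers and T ≥ q a positive integer. Then det(I_q + λᵀλ) = det(Σ_T) = 1/det(K). -/

import Mathlib

open Matrix

/-- An autocovariance sum split at `i`, for coefficients vanishing beyond `q`. -/
theorem sum_range_add_sum_Ico_eq (q i d : ℕ) (θ : ℕ → ℝ) (hsupp : ∀ l, q < l → θ l = 0) :
    ∑ s ∈ Finset.range (i + 1), θ s * θ (s + d) +
      ∑ s ∈ Finset.Ico (i + 1) (q + 1), θ s * θ (s + d) =
    if d ≤ q then ∑ s ∈ Finset.range (q - d + 1), θ s * θ (s + d) else 0 := by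
  have hunion : ∑ s ∈ Finset.range (i + 1), θ s * θ (s + d) +
      ∑ s ∈ Finset.Ico (i + 1) (q + 1), θ s * θ (s + d) =
      ∑ s ∈ Finset.range (max i q + 1), θ s * θ (s + d) := by
    rcases le_total i q with h | h
    · rw [max_eq_right h, Finset.sum_range_add_sum_Ico _ (by omega)]
    · rw [max_eq_left h, Finset.Ico_eq_empty (by omega), Finset.sum_empty, add_zero]
  rw [hunion]
  split_ifs with hd
  · symm
    refine Finset.sum_subset (fun s hs => ?_) (fun s _ hs => ?_)
    · simp only [Finset.mem_range] at hs ⊢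
      omega
    · simp only [Finset.mem_range] at hs
      rw [hsupp (s + d) (by omega), mul_zero]
  · exact Finset.sum_eq_zero fun s _ => by rw [hsupp (s + d) (by omega), mul_zero]

theorem sum_lowerToeplitz_mul (T i d : ℕ) (hi : i < T) (θ : ℕ → ℝ) :
    ∑ j ∈ Finset.range T, (if j ≤ i then θ (i - j) else 0) *
      (if j ≤ i + d then θ (i + d - j) else 0) =
    ∑ s ∈ Finset.range (i + 1), θ s * θ (s + d) := by
  rw [← Finset.sum_range_reflect _ (i + 1)]
  symm
  refine Finset.sum_subset_zero_on_sdiff (fun s hs => ?_) (fun s hs => ?_) (fun s hs => ?_)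
  · simp only [Finset.mem_range] at hs ⊢
    omega
  · simp only [Finset.mem_sdiff, Finset.mem_range] at hs
    rw [if_neg (by omega), zero_mul]
  · simp only [Finset.mem_range] at hs
    rw [if_pos (by omega), if_pos (by omega)]
    congr 2; omega

theorem sum_upperToeplitz_mul (q i d : ℕ) (θ : ℕ → ℝ) (hsupp : ∀ l, q < l → θ l = 0) :
    ∑ j ∈ Finset.range q, (if i ≤ j then θ (q - (j - i)) else 0) *
      (if i + d ≤ j then θ (q - (j - (i + d))) else 0) =
    ∑ s ∈ Finset.Ico (i + 1) (q + 1), θ s * θ (s + d) := by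
  have hsub : Finset.Ico i q ⊆ Finset.range q := fun s hs => by
    simp only [Finset.mem_range, Finset.mem_Ico] at hs ⊢
    omega
  rw [← Finset.sum_subset hsub fun s h1 h2 => by
    simp only [Finset.mem_range, Finset.mem_Ico] at h1 h2
    rw [if_neg (by omega), zero_mul]]
  refine Finset.sum_nbij' (fun j => q + i - j) (fun s => q + i - s) ?_ ?_ ?_ ?_ ?_
  any_goals
    intro s hs
    simp only [Finset.mem_Ico] at hs ⊢
    omega
  intro j hj
  simp only [Finset.mem_Ico] at hj
  rw [if_pos hj.1]
  split_ifs with h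
  · congr 2 <;> omega
  · rw [hsupp (q + i - j + d) (by omega), mul_zero, mul_zero]

/-- The Gram decomposition of the autocovariance matrix of a moving-average process, entrywise. -/
theorem sum_toeplitz_mul_add (q T i k : ℕ) (hi : i < T) (hk : k < T) (θ : ℕ → ℝ)
    (hsupp : ∀ l, q < l → θ l = 0) :
    ∑ j ∈ Finset.range T, (if j ≤ i then θ (i - j) else 0) *
        (if j ≤ k then θ (k - j) else 0) +
      ∑ j ∈ Finset.range q, (if i ≤ j then θ (q - (j - i)) else 0) *
        (if k ≤ j then θ (q - (j - k)) else 0) =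
    if ((i : ℤ) - (k : ℤ)).natAbs ≤ q then
      ∑ s ∈ Finset.range (q - ((i : ℤ) - (k : ℤ)).natAbs + 1),
        θ s * θ (s + ((i : ℤ) - (k : ℤ)).natAbs) else 0 := by
  wlog h : i ≤ k generalizing i k
  · rw [← Int.natAbs_neg, neg_sub, ← this k i hk hi (by omega)]
    simp only [mul_comm]
  obtain ⟨d, rfl⟩ := Nat.exists_eq_add_of_le h
  have hd : ((i : ℤ) - ((i + d : ℕ) : ℤ)).natAbs = d := by omega
  rw [hd, sum_lowerToeplitz_mul T i d hi, sum_upperToeplitz_mul q i d θ hsupp,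
    sum_range_add_sum_Ico_eq q i d θ hsupp]

theorem det_one_add_transpose_mul_pos {m n : Type*} [Fintype m] [Fintype n]
    [DecidableEq n] (A : Matrix m n ℝ) : 0 < (1 + Aᵀ * A).det := by
  have h : (Aᵀ * A).PosSemidef := by
    simpa using Matrix.posSemidef_conjTranspose_mul_self A
  exact (Matrix.PosDef.one.add_posSemidef h).det_pos

theorem det_one_sub_mul_inv_mul_transpose {m n : Type*} [Fintype m] [Fintype n]
    [DecidableEq m] [DecidableEq n] (A : Matrix m n ℝ) :
    (1 - A * (1 + Aᵀ * A)⁻¹ * Aᵀ).det = ((1 + Aᵀ * A).det)⁻¹ := by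
  have hu : IsUnit (1 + Aᵀ * A).det := (det_one_add_transpose_mul_pos A).ne'.isUnit
  have h : 1 - (1 + Aᵀ * A)⁻¹ * Aᵀ * A = (1 + Aᵀ * A)⁻¹ := by
    have h1 := Matrix.nonsing_inv_mul _ hu
    rw [mul_add, mul_one, ← Matrix.mul_assoc] at h1
    exact sub_eq_iff_eq_add.mpr h1.symm
  rw [Matrix.mul_assoc, Matrix.det_one_sub_mul_comm, h, Matrix.det_nonsing_inv,
    Ring.inverse_eq_inv']

/-- Matrix determinant lemma for a sum of two Gram matrices. -/
theorem det_mul_transpose_add_mul_transpose {m n : Type*} [Fintype m] [Fintype n]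
    [DecidableEq m] [DecidableEq n] (B : Matrix m m ℝ) (C : Matrix m n ℝ) (hB : IsUnit B.det) :
    (B * Bᵀ + C * Cᵀ).det = B.det ^ 2 * (1 + (B⁻¹ * C)ᵀ * (B⁻¹ * C)).det := by
  have hC : B * (B⁻¹ * C) = C := Matrix.mul_nonsing_inv_cancel_left _ _ hB
  have h : B * Bᵀ + C * Cᵀ = B * (1 + (B⁻¹ * C) * (B⁻¹ * C)ᵀ) * Bᵀ := by
    conv_lhs => rw [← hC]
    simp only [Matrix.transpose_mul B (B⁻¹ * C), mul_add, add_mul, mul_one, Matrix.mul_assoc]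
  rw [h, Matrix.det_mul, Matrix.det_mul, Matrix.det_transpose, Matrix.det_one_add_mul_comm]
  ring

/-- For `θ_0 = 1, θ_1, …, θ_q` and `T ≥ q`, with `λ = Θ_T⁻¹ Θ_{*;T−q}` and
`K = I_T − λ(I_q + λᵀλ)⁻¹λᵀ`: `det(I_q + λᵀλ) = det(Σ_T) = 1/det(K)`. -/
theorem stmt_8 (q T : ℕ) (hq : 0 < q) (hqT : q ≤ T)
    (θ : ℕ → ℝ) (h0 : θ 0 = 1) (hsupp : ∀ l, q < l → θ l = 0) :
    let Θ : Matrix (Fin T) (Fin T) ℝ :=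
      Matrix.of fun i j => if (j : ℕ) ≤ (i : ℕ) then θ ((i : ℕ) - (j : ℕ)) else 0
    let Θstar : Matrix (Fin T) (Fin q) ℝ :=
      Matrix.of fun i j =>
        if (i : ℕ) ≤ (j : ℕ) then θ (q - ((j : ℕ) - (i : ℕ))) else 0
    let γ : ℕ → ℝ := fun l =>
      if l ≤ q then ∑ j ∈ Finset.range (q - l + 1), θ j * θ (j + l) else 0
    let Sg : Matrix (Fin T) (Fin T) ℝ :=
      Matrix.of fun i j => γ (((i : ℕ) : ℤ) - ((j : ℕ) : ℤ)).natAbs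
    let lam : Matrix (Fin T) (Fin q) ℝ := Θ⁻¹ * Θstar
    let K : Matrix (Fin T) (Fin T) ℝ := 1 - lam * (1 + lamᵀ * lam)⁻¹ * lamᵀ
    (1 + lamᵀ * lam).det = Sg.det ∧ Sg.det = 1 / K.det := by
  intro Θ Θstar γ Sg lam K
  have hdet : Θ.det = 1 := by
    rw [Matrix.det_of_isLowerTriangular]
    · simp [Θ, h0]
    · intro i j hij
      have hij' : i < j := hij
      simp [Θ, hij']
  have hSg : Sg = Θ * Θᵀ + Θstar * Θstarᵀ := by
    ext i k
    have h := sum_toeplitz_mul_add q T i k i.2 k.2 θ hsupp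
    rw [Finset.sum_range, Finset.sum_range] at h
    simp only [Matrix.add_apply, Matrix.mul_apply, Matrix.transpose_apply]
    exact h.symm
  have hlam : (1 + lamᵀ * lam).det = Sg.det := by
    rw [hSg, det_mul_transpose_add_mul_transpose _ _ (by simp [hdet]), hdet, one_pow, one_mul]
  exact ⟨hlam, by rw [det_one_sub_mul_inv_mul_transpose, one_div, inv_inv, hlam]⟩
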